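/- The horizontal component x of the Peano curve satisfies the following nine self-similarity relations: x(t) = (1/3)x(9t) for t ∈ [0,1/9]; x(t) = (1/3)x(2-9t) for t ∈ [1/9,2/9]; x(t) = (1/3)x(9t-2) for t ∈ [2/9,3/9]; x(t) = 1/3 + (1/3)x(9t-3) for t ∈ [3/9,4/9]; x(t) = 1/3 + (1/3)x(5-9t) for t ∈ [4/9,5/9]; x(t) = 1/3 + (1/3)x(9t-5) for t ∈ [5/9,6/9]; x(t) = 2/3 + (1/3)x(9t-6) for t ∈ [6/9,7/9]; x(t) = 2/3 + (1/3)x(8-9t) for t ∈ [7/9,8/9]; x(t) = 2/3 + (1/3)x(9t-8) for t ∈ [8/9,1]. -/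

import Mathlib

open scoped BigOperators Classical
open Filter

noncomputable section

/-- The digit map `k n = 2 - n` on `{0,1,2}` (with truncated natural subtraction). -/
def peanoK : ℕ → ℕ := fun n => 2 - n

/-- The `m`-th (0-indexed) ternary digit of the horizontal component of the Peano curve
evaluated at the point with ternary digits `d` (0-indexed, i.e. `t_j = d (j-1)`):
the `j`-th digit of `x(t)` is `k^[t_2 + t_4 + ⋯ + t_{2j-2}] (t_{2j-1})`. -/
def peanoXDigit (d : ℕ → Fin 3) (m : ℕ) : ℕ :=
  peanoK^[∑ i ∈ Finset.range m, (d (2 * i + 1) : ℕ)] (d (2 * m) : ℕ)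

/-- `x : ℝ → ℝ` is (on `[0,1]`) the horizontal component of the Peano curve:
for every ternary expansion `t = Σ_j d_j 3^{-(j+1)}`, `x t` is given by the digit formula. -/
def IsPeanoX (x : ℝ → ℝ) : Prop :=
  ∀ d : ℕ → Fin 3,
    x (∑' j : ℕ, (d j : ℝ) / 3 ^ (j + 1)) = ∑' m : ℕ, (peanoXDigit d m : ℝ) / 3 ^ (m + 1)

/-- The grid `cℤ + r = {cq + r : q ∈ ℤ}`. -/
def peanoGrid (c r : ℝ) : Set ℝ := {u : ℝ | ∃ q : ℤ, u = c * q + r}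

/-- `lebTime x c r m` is the time `t_{m+1}(c,r)` of the Lebesgue partition `π(c,r)` for `x`
on `[0,1]` (values in `[0,1] ∪ {+∞}`, modelled in `EReal`; `sInf ∅ = ⊤ = +∞`). -/
def lebTime (x : ℝ → ℝ) (c r : ℝ) : ℕ → EReal
  | 0 => sInf (Real.toEReal '' {t : ℝ | t ∈ Set.Icc (0 : ℝ) 1 ∧ x t ∈ peanoGrid c r})
  | m + 1 =>
    if lebTime x c r m = ⊤ then ⊤
    else
      sInf (Real.toEReal ''
        {t : ℝ | t ∈ Set.Icc ((lebTime x c r m).toReal) 1 ∧ x t ∈ peanoGrid c r ∧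
          x t ≠ x ((lebTime x c r m).toReal)})

/-- `k(c,r,t) = min{m ∈ ℕ₊ : t_m(c,r) ≥ t}` (recall `t_m(c,r) = lebTime x c r (m-1)`). -/
def kIdx (x : ℝ → ℝ) (c r t : ℝ) : ℕ :=
  sInf {m : ℕ | 1 ≤ m ∧ (t : EReal) ≤ lebTime x c r (m - 1)}

/-- `l(c,r,t) = max{m ∈ ℕ₊ : t_m(c,r) ≤ t}`. -/
def lIdx (x : ℝ → ℝ) (c r t : ℝ) : ℕ :=
  sSup {m : ℕ | 1 ≤ m ∧ lebTime x c r (m - 1) ≤ (t : EReal)}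

/-- The quadratic variation `[x]_{s,t}^{c,r}` of `x` on `[s,t]` along the Lebesgue partition
`π(c,r)`: the sum over `m = k(c,r,s), …, l(c,r,t) - 1` of `(x(t_{m+1}) - x(t_m))²`. -/
def qvar (x : ℝ → ℝ) (c r s t : ℝ) : ℝ :=
  ∑ m ∈ Finset.Ico (kIdx x c r s) (lIdx x c r t),
    (x ((lebTime x c r m).toReal) - x ((lebTime x c r (m - 1)).toReal)) ^ 2

/-- `[x]_t^{c,r} := [x]_{0,t}^{c,r}`. -/
def qvar0 (x : ℝ → ℝ) (c r t : ℝ) : ℝ := qvar x c r 0 t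

open Real in
/-- The digit expansion with every digit `i` replaced by `b - 1 - i` represents `1 - y`. -/
theorem ofDigits_rev {b : ℕ} (hb : 1 < b) (d : ℕ → Fin b) :
    ofDigits (fun i ↦ (d i).rev) = 1 - ofDigits d := by
  rw [eq_sub_iff_add_eq, ← ofDigits_const_last_eq_one' hb]
  simp only [ofDigits]
  rw [← summable_ofDigitsTerm.tsum_add summable_ofDigitsTerm]
  congr 1
  ext i
  simp only [ofDigitsTerm, ← add_mul, ← Nat.cast_add]
  congr 2
  have := (d i).isLt
  rw [Fin.val_rev]
  omega

/-- The ternary digits of the horizontal component of the Peano curve, as elements of `Fin 3`. -/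
def peanoXFin (d : ℕ → Fin 3) (m : ℕ) : Fin 3 :=
  Fin.rev^[∑ i ∈ Finset.range m, (d (2 * i + 1) : ℕ)] (d (2 * m))

theorem val_rev_iterate (n : ℕ) (i : Fin 3) : (Fin.rev^[n] i : ℕ) = peanoK^[n] i := by
  have h : Function.Semiconj (Fin.val : Fin 3 → ℕ) Fin.rev peanoK := fun j ↦ by
    simp only [peanoK, Fin.val_rev]
    omega
  exact h.iterate_right n i

theorem IsPeanoX.apply_ofDigits {x : ℝ → ℝ} (hx : IsPeanoX x) (d : ℕ → Fin 3) :
    x (Real.ofDigits d) = Real.ofDigits (peanoXFin d) := by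
  have h := hx d
  simpa only [Real.ofDigits, Real.ofDigitsTerm, peanoXFin, val_rev_iterate, peanoXDigit,
    div_eq_mul_inv, Nat.cast_ofNat] using h

theorem rev_iterate_of_even {b n : ℕ} (hn : Even n) (i : Fin b) : Fin.rev^[n] i = i := by
  rw [Fin.rev_involutive.iterate_even hn, id]

theorem peanoXFin_rev (d : ℕ → Fin 3) :
    peanoXFin (fun i ↦ (d i).rev) = fun m ↦ (peanoXFin d m).rev := by
  ext1 m
  have hsum : (∑ i ∈ Finset.range m, ((d (2 * i + 1)).rev : ℕ)) +
      ∑ i ∈ Finset.range m, (d (2 * i + 1) : ℕ) = m * 2 := by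
    rw [← Finset.sum_add_distrib, Finset.sum_congr rfl (g := fun _ ↦ 2), Finset.sum_const,
      Finset.card_range, smul_eq_mul]
    intro i _
    rw [Fin.val_rev]
    omega
  apply (Fin.rev_injective.iterate (∑ i ∈ Finset.range m, (d (2 * i + 1) : ℕ)))
  simp only [peanoXFin]
  rw [← Function.iterate_add_apply, add_comm, hsum, rev_iterate_of_even ⟨m, by ring⟩,
    ← Function.iterate_succ_apply' Fin.rev, ← Function.iterate_add_apply,
    Nat.add_succ, Function.iterate_succ_apply', rev_iterate_of_even ⟨_, rfl⟩]

/-- The horizontal component of the Peano curve is symmetric about the centre of the square. -/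
theorem IsPeanoX.apply_one_sub {x : ℝ → ℝ} (hx : IsPeanoX x) {v : ℝ}
    (hv : v ∈ Set.Icc (0 : ℝ) 1) : x (1 - v) = 1 - x v := by
  obtain ⟨d, -, rfl⟩ := Real.ofDigits_SurjOn (b := 3) (by norm_num) hv
  rw [← ofDigits_rev (by norm_num), hx.apply_ofDigits, hx.apply_ofDigits, peanoXFin_rev,
    ofDigits_rev (by norm_num)]

/-- Removing the first pair of digits `a, b` applies `Fin.rev^[b]` to all later digits. -/
theorem peanoXFin_succ (d : ℕ → Fin 3) (m : ℕ) :
    peanoXFin d (m + 1) = Fin.rev^[(d 1 : ℕ)] (peanoXFin (fun i ↦ d (i + 2)) m) := by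
  simp only [peanoXFin]
  rw [← Function.iterate_add_apply, Finset.sum_range_succ', add_comm]
  rfl

theorem IsPeanoX.apply_block {x : ℝ → ℝ} (hx : IsPeanoX x) (a b : Fin 3) {v : ℝ}
    (hv : v ∈ Set.Icc (0 : ℝ) 1) :
    x ((3 * (a : ℕ) + (b : ℕ) + v) / 9) = ((a : ℕ) + if b = 1 then x (1 - v) else x v) / 3 := by
  rw [hx.apply_one_sub hv]
  obtain ⟨e, -, rfl⟩ := Real.ofDigits_SurjOn (b := 3) (by norm_num) hv
  let d : ℕ → Fin 3
    | 0 => a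
    | 1 => b
    | n + 2 => e n
  have hd : (3 * ((a : ℕ) : ℝ) + (b : ℕ) + Real.ofDigits e) / 9 = Real.ofDigits d := by
    rw [Real.ofDigits_eq_sum_add_ofDigits d 2]
    simp only [Finset.sum_range_succ, Finset.sum_range_zero, Real.ofDigitsTerm, d]
    push_cast
    ring
  rw [hd, hx.apply_ofDigits, hx.apply_ofDigits, Real.ofDigits_eq_sum_add_ofDigits _ 1,
    ← ofDigits_rev (by norm_num)]
  simp only [peanoXFin_succ]
  have hdigit : (if b = 1 then Real.ofDigits (fun i ↦ (peanoXFin e i).rev)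
      else Real.ofDigits (peanoXFin e)) =
      Real.ofDigits (fun m ↦ Fin.rev^[(b : ℕ)] (peanoXFin e m)) := by
    fin_cases b <;> simp
  rw [hdigit]
  simp only [Finset.sum_range_one, Real.ofDigitsTerm, peanoXFin, Finset.sum_range_zero,
    Function.iterate_zero, id, d]
  push_cast
  ring

/-- The nine self-similarity relations of the horizontal component of the Peano curve. -/
theorem peano_self_similarity (x : ℝ → ℝ) (hx : IsPeanoX x) :
    (∀ t ∈ Set.Icc (0 : ℝ) (1 / 9), x t = 1 / 3 * x (9 * t)) ∧
    (∀ t ∈ Set.Icc (1 / 9 : ℝ) (2 / 9), x t = 1 / 3 * x (2 - 9 * t)) ∧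
    (∀ t ∈ Set.Icc (2 / 9 : ℝ) (3 / 9), x t = 1 / 3 * x (9 * t - 2)) ∧
    (∀ t ∈ Set.Icc (3 / 9 : ℝ) (4 / 9), x t = 1 / 3 + 1 / 3 * x (9 * t - 3)) ∧
    (∀ t ∈ Set.Icc (4 / 9 : ℝ) (5 / 9), x t = 1 / 3 + 1 / 3 * x (5 - 9 * t)) ∧
    (∀ t ∈ Set.Icc (5 / 9 : ℝ) (6 / 9), x t = 1 / 3 + 1 / 3 * x (9 * t - 5)) ∧
    (∀ t ∈ Set.Icc (6 / 9 : ℝ) (7 / 9), x t = 2 / 3 + 1 / 3 * x (9 * t - 6)) ∧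
    (∀ t ∈ Set.Icc (7 / 9 : ℝ) (8 / 9), x t = 2 / 3 + 1 / 3 * x (8 - 9 * t)) ∧
    (∀ t ∈ Set.Icc (8 / 9 : ℝ) 1, x t = 2 / 3 + 1 / 3 * x (9 * t - 8)) := by
  refine ⟨?_, ?_, ?_, ?_, ?_, ?_, ?_, ?_, ?_⟩ <;> rintro t ⟨h₁, h₂⟩
  · have h := hx.apply_block 0 0 (v := 9 * t - 0) ⟨by linarith, by linarith⟩
    norm_num at h
    ring_nf at h ⊢
    exact h
  · have h := hx.apply_block 0 1 (v := 9 * t - 1) ⟨by linarith, by linarith⟩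
    norm_num at h
    ring_nf at h ⊢
    exact h
  · have h := hx.apply_block 0 2 (v := 9 * t - 2) ⟨by linarith, by linarith⟩
    norm_num at h
    ring_nf at h ⊢
    exact h
  · have h := hx.apply_block 1 0 (v := 9 * t - 3) ⟨by linarith, by linarith⟩
    norm_num at h
    ring_nf at h ⊢
    exact h
  · have h := hx.apply_block 1 1 (v := 9 * t - 4) ⟨by linarith, by linarith⟩
    norm_num at h
    ring_nf at h ⊢
    exact h
  · have h := hx.apply_block 1 2 (v := 9 * t - 5) ⟨by linarith, by linarith⟩
    norm_num at h
    ring_nf at h ⊢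
    exact h
  · have h := hx.apply_block 2 0 (v := 9 * t - 6) ⟨by linarith, by linarith⟩
    norm_num at h
    ring_nf at h ⊢
    exact h
  · have h := hx.apply_block 2 1 (v := 9 * t - 7) ⟨by linarith, by linarith⟩
    norm_num at h
    ring_nf at h ⊢
    exact h
  · have h := hx.apply_block 2 2 (v := 9 * t - 8) ⟨by linarith, by linarith⟩
    norm_num at h
    ring_nf at h ⊢
    exact h
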